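/- arXiv:2003.03673 — 2 statements merged into one kernel-verified Lean document; each statement's English description precedes it below -/
import Mathlib

section
/- Let N ≥ 3 be an integer, x₀ ∈ ℝ^N, S_{x₀}(x) := 1/((N−2)ω_N |x−x₀|^{N−2}), and let Φ be a real function that is continuously differentiable on an open neighborhood of x₀. Then lim_{θ→0⁺} P_θ(S_{x₀}, Φ) = ((N−2)/4) Φ(x₀). -/
open MeasureTheory Metric Real
open scoped RealInnerProductSpace ENNReal

/-- The Euclidean Laplacian `Δu = Σ_{i=1}^N ∂²u/∂x_i²` on `ℝ^N`. -/
noncomputable def laplacian {N : ℕ} (u : EuclideanSpace ℝ (Fin N) → ℝ)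
    (x : EuclideanSpace ℝ (Fin N)) : ℝ :=
  ∑ i : Fin N, fderiv ℝ (fun y => fderiv ℝ u y (EuclideanSpace.single i 1)) x
    (EuclideanSpace.single i 1)

/-- The quadratic boundary form
`P_θ(u,v) = -θ∫_{∂B_θ(x₀)} ⟨∇u,ν⟩⟨∇v,ν⟩ + (θ/2)∫ ⟨∇u,∇v⟩
  + ((2-N)/4)∫ ⟨∇u,ν⟩ v + ((2-N)/4)∫ ⟨∇v,ν⟩ u`,
where `ν(x) = (x-x₀)/θ` and integrals are over the sphere `∂B_θ(x₀)` with respect to the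
`(N-1)`-dimensional Hausdorff measure. -/
noncomputable def Pform {N : ℕ} (x₀ : EuclideanSpace ℝ (Fin N)) (θ : ℝ)
    (u v : EuclideanSpace ℝ (Fin N) → ℝ) : ℝ :=
  -θ * ∫ x in sphere x₀ θ,
      (⟪gradient u x, θ⁻¹ • (x - x₀)⟫) * (⟪gradient v x, θ⁻¹ • (x - x₀)⟫) ∂μH[(N : ℝ) - 1]
  + (θ / 2) * ∫ x in sphere x₀ θ,
      (⟪gradient u x, gradient v x⟫) ∂μH[(N : ℝ) - 1]
  + ((2 - (N : ℝ)) / 4) * ∫ x in sphere x₀ θ,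
      (⟪gradient u x, θ⁻¹ • (x - x₀)⟫) * v x ∂μH[(N : ℝ) - 1]
  + ((2 - (N : ℝ)) / 4) * ∫ x in sphere x₀ θ,
      (⟪gradient v x, θ⁻¹ • (x - x₀)⟫) * u x ∂μH[(N : ℝ) - 1]

/-- The quadratic boundary form
`Q_{θ,i}(u,v) = -∫_{∂B_θ(x₀)} ⟨∇v,ν⟩ ∂u/∂x_i - ∫ ⟨∇u,ν⟩ ∂v/∂x_i + ∫ ⟨∇u,∇v⟩ ν_i`,
where `ν(x) = (x-x₀)/θ` and integrals are over the sphere `∂B_θ(x₀)` with respect to the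
`(N-1)`-dimensional Hausdorff measure. -/
noncomputable def Qform {N : ℕ} (x₀ : EuclideanSpace ℝ (Fin N)) (θ : ℝ) (i : Fin N)
    (u v : EuclideanSpace ℝ (Fin N) → ℝ) : ℝ :=
  -(∫ x in sphere x₀ θ,
      (⟪gradient v x, θ⁻¹ • (x - x₀)⟫) * fderiv ℝ u x (EuclideanSpace.single i 1)
        ∂μH[(N : ℝ) - 1])
  - ∫ x in sphere x₀ θ,
      (⟪gradient u x, θ⁻¹ • (x - x₀)⟫) * fderiv ℝ v x (EuclideanSpace.single i 1)
        ∂μH[(N : ℝ) - 1]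
  + ∫ x in sphere x₀ θ,
      (⟪gradient u x, gradient v x⟫) * ((x - x₀) i / θ) ∂μH[(N : ℝ) - 1]

/-- The `(N-1)`-dimensional surface measure of the unit sphere in `ℝ^N`. -/
noncomputable def omegaN (N : ℕ) : ℝ :=
  (μH[(N : ℝ) - 1] (sphere (0 : EuclideanSpace ℝ (Fin N)) 1)).toReal

/-- The fundamental solution `S_{x₀}(x) = 1/((N-2) ω_N |x-x₀|^{N-2})` of `-Δ` with pole `x₀`. -/
noncomputable def fundSol {N : ℕ} (x₀ x : EuclideanSpace ℝ (Fin N)) : ℝ :=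
  1 / (((N : ℝ) - 2) * omegaN N * ‖x - x₀‖ ^ (N - 2))

/-- `W_{x₀,h}(x) = (x_h - (x₀)_h)/(ω_N |x-x₀|^N)`, the partial derivative of
`S_{x₀}(x)` with respect to the `h`-th coordinate of the pole `x₀`. -/
noncomputable def poleDeriv {N : ℕ} (x₀ : EuclideanSpace ℝ (Fin N)) (h : Fin N)
    (x : EuclideanSpace ℝ (Fin N)) : ℝ :=
  (x h - x₀ h) / (omegaN N * ‖x - x₀‖ ^ N)

section HausdorffSphere

open Module

variable {E : Type*} [NormedAddCommGroup E] [InnerProductSpace ℝ E]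

/-- Every point of the unit sphere in the open hemisphere opposite to `v` is the image under
inverse stereographic projection from `v` of a point of the closed ball of radius `2`. -/
theorem sphere_inter_inner_neg_subset_image_stereoInvFunAux {v : E} (hv : ‖v‖ = 1) :
    sphere (0 : E) 1 ∩ {y | ⟪v, y⟫ < 0} ⊆
      (fun w : (ℝ ∙ v)ᗮ => stereoInvFunAux v (w : E)) '' closedBall 0 2 := by
  rintro y ⟨hy, hvy⟩
  have hvy' : ⟪v, y⟫ < 0 := hvy
  have hne : y ≠ v := by
    rintro rfl
    rw [real_inner_self_eq_norm_sq, hv] at hvy'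
    norm_num at hvy'
  refine ⟨stereoToFun v y, ?_, ?_⟩
  · rw [mem_closedBall_zero_iff, stereoToFun_apply, norm_smul, innerSL_apply_apply,
      Real.norm_eq_abs, abs_of_pos (by apply div_pos <;> linarith)]
    have h₁ : ‖(ℝ ∙ v)ᗮ.orthogonalProjectionOnto y‖ ≤ 1 := by
      have := (ℝ ∙ v)ᗮ.norm_orthogonalProjectionOnto_apply_le y
      rwa [mem_sphere_zero_iff_norm.mp hy] at this
    have h₂ : 2 / (1 - ⟪v, y⟫) ≤ 2 := by
      rw [div_le_iff₀ (by linarith)]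
      linarith
    calc _ ≤ 2 * 1 := mul_le_mul h₂ h₁ (norm_nonneg _) (by norm_num)
      _ = 2 := mul_one 2
  · exact congrArg Subtype.val (stereo_left_inv hv (x := ⟨y, hy⟩) hne)

theorem ball_subset_image_orthogonalProjectionOnto_sphere {v : E} (hv : ‖v‖ = 1) :
    ball (0 : (ℝ ∙ v)ᗮ) 1 ⊆ (ℝ ∙ v)ᗮ.orthogonalProjectionOnto '' sphere (0 : E) 1 := by
  intro w hw
  rw [mem_ball_zero_iff] at hw
  have hwv : ⟪(w : E), v⟫ = 0 := Submodule.mem_orthogonal_singleton_iff_inner_left.mp w.2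
  have hv' : (ℝ ∙ v)ᗮ.orthogonalProjectionOnto v = 0 :=
    Submodule.orthogonalProjectionOnto_orthogonal_apply_eq_zero
      (Submodule.mem_span_singleton_self v)
  refine ⟨(w : E) + √(1 - ‖w‖ ^ 2) • v, ?_, ?_⟩
  · rw [mem_sphere_zero_iff_norm, ← sq_eq_sq₀ (norm_nonneg _) zero_le_one, norm_add_sq_real,
      inner_smul_right, hwv, norm_smul, hv, mul_one, Real.norm_eq_abs, sq_abs,
      Real.sq_sqrt (by nlinarith [norm_nonneg w]), Submodule.coe_norm]
    ring
  · simp [hv']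

variable [MeasurableSpace E] [BorelSpace E] {n : ℕ}

theorem hausdorffMeasure_sphere (x₀ : E) {θ : ℝ} (hθ : 0 < θ) :
    μH[n] (sphere x₀ θ) = ENNReal.ofReal (θ ^ n) * μH[n] (sphere (0 : E) 1) := by
  have h : sphere x₀ θ = IsometryEquiv.addRight x₀ '' ((· • ·) θ '' sphere (0 : E) 1) := by
    rw [Set.image_smul, smul_sphere' hθ.ne']
    ext y
    simp [abs_of_pos hθ, mem_sphere_iff_norm, sub_eq_add_neg]
  rw [h, IsometryEquiv.hausdorffMeasure_image, Set.image_smul,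
    Measure.hausdorffMeasure_smul₀ n.cast_nonneg hθ.ne', NNReal.rpow_natCast, ENNReal.smul_def,
    smul_eq_mul, ENNReal.ofReal_pow hθ.le, ENNReal.coe_pow, ← Real.enorm_of_nonneg hθ.le]
  rfl

variable [FiniteDimensional ℝ E]

theorem isAddHaarMeasure_hausdorffMeasure_orthogonal_span_singleton
    (hE : finrank ℝ E = n + 1) {v : E} (hv : ‖v‖ = 1) :
    (μH[n] : Measure (ℝ ∙ v)ᗮ).IsAddHaarMeasure := by
  have : Fact (finrank ℝ E = n + 1) := ⟨hE⟩
  have hv0 : v ≠ 0 := by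
    rintro rfl
    simp at hv
  have h := MeasureTheory.isAddHaarMeasure_hausdorffMeasure (E := (ℝ ∙ v)ᗮ)
  rwa [Submodule.finrank_orthogonal_span_singleton (n := n) hv0] at h

theorem hausdorffMeasure_unitSphere_lt_top (hE : finrank ℝ E = n + 1) :
    μH[n] (sphere (0 : E) 1) < ∞ := by
  refine (isCompact_sphere (0 : E) 1).measure_lt_top_of_nhdsWithin fun x hx => ?_
  have hv : ‖-x‖ = 1 := by simpa using hx
  have := isAddHaarMeasure_hausdorffMeasure_orthogonal_span_singleton hE hv
  refine ⟨sphere (0 : E) 1 ∩ {y | ⟪-x, y⟫ < 0}, ?_, ?_⟩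
  · refine inter_mem_nhdsWithin _ (IsOpen.mem_nhds ?_ ?_)
    · exact isOpen_lt (by fun_prop) continuous_const
    · have : ‖x‖ = 1 := by simpa using hx
      simp [this]
  · have hf : ContDiff ℝ 1 (fun w : (ℝ ∙ (-x))ᗮ => stereoInvFunAux (-x) (w : E)) :=
      contDiff_stereoInvFunAux.comp (ℝ ∙ (-x))ᗮ.subtypeL.contDiff
    have hK : IsCompact (closedBall (0 : (ℝ ∙ (-x))ᗮ) 2) := isCompact_closedBall _ _
    obtain ⟨K, hL⟩ :=
      (hf.locallyLipschitz.locallyLipschitzOn).exists_lipschitzOnWith_of_compact hK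
    calc _ ≤ _ := measure_mono (sphere_inter_inner_neg_subset_image_stereoInvFunAux hv)
      _ ≤ _ := hL.hausdorffMeasure_image_le n.cast_nonneg
      _ < ∞ := ENNReal.mul_lt_top
        (ENNReal.rpow_lt_top_of_nonneg n.cast_nonneg ENNReal.coe_ne_top) hK.measure_lt_top

theorem hausdorffMeasure_unitSphere_pos (hE : finrank ℝ E = n + 1) :
    0 < μH[n] (sphere (0 : E) 1) := by
  have : Nontrivial E := nontrivial_of_finrank_pos (R := ℝ) (by omega)
  obtain ⟨v, hv⟩ := exists_norm_eq E zero_le_one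
  have := isAddHaarMeasure_hausdorffMeasure_orthogonal_span_singleton hE hv
  have hL : LipschitzWith 1 (ℝ ∙ v)ᗮ.orthogonalProjectionOnto :=
    LipschitzWith.of_dist_le_mul fun x y => by
      rw [dist_eq_norm, dist_eq_norm, ← map_sub, NNReal.coe_one, one_mul]
      exact (ℝ ∙ v)ᗮ.norm_orthogonalProjectionOnto_apply_le (x - y)
  calc 0 < μH[n] (ball (0 : (ℝ ∙ v)ᗮ) 1) := measure_ball_pos _ _ one_pos
    _ ≤ _ := measure_mono (ball_subset_image_orthogonalProjectionOnto_sphere hv)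
    _ ≤ _ := hL.hausdorffMeasure_image_le n.cast_nonneg _
    _ = _ := by simp

end HausdorffSphere

theorem omegaN_pos {N : ℕ} (hN : 1 ≤ N) : 0 < omegaN N := by
  obtain ⟨n, rfl⟩ := Nat.exists_eq_add_of_le' hN
  have hE : Module.finrank ℝ (EuclideanSpace ℝ (Fin (n + 1))) = n + 1 := finrank_euclideanSpace_fin
  rw [omegaN, Nat.cast_succ, add_sub_cancel_right]
  exact ENNReal.toReal_pos (hausdorffMeasure_unitSphere_pos hE).ne'
    (hausdorffMeasure_unitSphere_lt_top hE).ne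

theorem hausdorffMeasure_sphere_lt_top {N : ℕ} (hN : 1 ≤ N) (x₀ : EuclideanSpace ℝ (Fin N))
    {θ : ℝ} (hθ : 0 < θ) : μH[(N : ℝ) - 1] (sphere x₀ θ) < ∞ := by
  obtain ⟨n, rfl⟩ := Nat.exists_eq_add_of_le' hN
  rw [Nat.cast_succ, add_sub_cancel_right, hausdorffMeasure_sphere x₀ hθ]
  exact ENNReal.mul_lt_top ENNReal.ofReal_lt_top
    (hausdorffMeasure_unitSphere_lt_top finrank_euclideanSpace_fin)

theorem hausdorffMeasure_real_sphere {N : ℕ} (hN : 1 ≤ N) (x₀ : EuclideanSpace ℝ (Fin N))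
    {θ : ℝ} (hθ : 0 < θ) :
    (μH[(N : ℝ) - 1] : Measure (EuclideanSpace ℝ (Fin N))).real (sphere x₀ θ) =
      θ ^ (N - 1) * omegaN N := by
  obtain ⟨n, rfl⟩ := Nat.exists_eq_add_of_le' hN
  rw [omegaN, measureReal_def, Nat.cast_succ, add_sub_cancel_right, hausdorffMeasure_sphere x₀ hθ,
    ENNReal.toReal_mul, ENNReal.toReal_ofReal (by positivity), Nat.add_sub_cancel]

theorem hasGradientAt_norm_sub {F : Type*} [NormedAddCommGroup F] [InnerProductSpace ℝ F]
    [CompleteSpace F] {x₀ x : F} (hx : x ≠ x₀) :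
    HasGradientAt (fun y => ‖y - x₀‖) (‖x - x₀‖⁻¹ • (x - x₀)) x := by
  have h₀ : ‖x - x₀‖ ^ 2 ≠ 0 := pow_ne_zero _ (norm_ne_zero_iff.mpr (sub_ne_zero.mpr hx))
  have h := (((hasFDerivAt_id x).sub_const x₀).norm_sq).sqrt h₀
  simp only [Real.sqrt_sq (norm_nonneg _), id_eq] at h
  rw [hasGradientAt_iff_hasFDerivAt]
  convert! h using 1
  ext y
  simp
  ring

theorem hasGradientAt_fundSol {N : ℕ} (hN : 3 ≤ N) {x₀ x : EuclideanSpace ℝ (Fin N)}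
    (hx : x ≠ x₀) :
    HasGradientAt (fundSol x₀) (-(omegaN N * ‖x - x₀‖ ^ N)⁻¹ • (x - x₀)) x := by
  have hω := (omegaN_pos (show 1 ≤ N by omega)).ne'
  obtain ⟨m, rfl⟩ := Nat.exists_eq_add_of_le' hN
  have hr : ‖x - x₀‖ ≠ 0 := norm_ne_zero_iff.mpr (sub_ne_zero.mpr hx)
  have hm : ((m + 3 : ℕ) : ℝ) - 2 = m + 1 := by push_cast; ring
  have hm' : (m : ℝ) + 1 ≠ 0 := by positivity
  have hd : HasDerivAt (fun r : ℝ => 1 / (((m : ℝ) + 1) * omegaN (m + 3) * r ^ (m + 1)))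
      (-(omegaN (m + 3) * ‖x - x₀‖ ^ (m + 2))⁻¹) ‖x - x₀‖ := by
    have h := (((hasDerivAt_pow (m + 1) ‖x - x₀‖).const_mul
      (((m : ℝ) + 1) * omegaN (m + 3))).inv (by positivity))
    simp only [one_div]
    convert! h using 1
    simp only [Nat.add_sub_cancel]
    push_cast
    field_simp
    ring
  have h := hd.comp_hasFDerivAt x (hasGradientAt_iff_hasFDerivAt.mp (hasGradientAt_norm_sub hx))
  rw [hasGradientAt_iff_hasFDerivAt]
  have hS : fundSol x₀ = (fun r : ℝ => 1 / (((m : ℝ) + 1) * omegaN (m + 3) * r ^ (m + 1))) ∘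
      fun y => ‖y - x₀‖ := by
    ext y
    simp only [fundSol, hm, Function.comp_apply]
    rfl
  rw [hS]
  convert! h using 1
  rw [← map_smul, smul_smul]
  congr 2
  field_simp
  ring

/-- Explicit evaluation of `P_θ(S_{x₀}, v)` through averages over the sphere. -/
theorem Pform_fundSol_eq {N : ℕ} (hN : 3 ≤ N) (x₀ : EuclideanSpace ℝ (Fin N)) {θ : ℝ}
    (hθ : 0 < θ) (v : EuclideanSpace ℝ (Fin N) → ℝ) :
    Pform x₀ θ (fundSol x₀) v =
      θ / 4 * (⨍ x in sphere x₀ θ, ⟪gradient v x, θ⁻¹ • (x - x₀)⟫ ∂μH[(N : ℝ) - 1]) +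
        ((N : ℝ) - 2) / 4 * ⨍ x in sphere x₀ θ, v x ∂μH[(N : ℝ) - 1] := by
  have hω := omegaN_pos (show 1 ≤ N by omega)
  have hs : MeasurableSet (sphere x₀ θ) := isClosed_sphere.measurableSet
  have hgrad : ∀ x ∈ sphere x₀ θ,
      gradient (fundSol x₀) x = -(omegaN N * θ ^ (N - 1))⁻¹ • (θ⁻¹ • (x - x₀)) := by
    intro x hx
    have hx' := mem_sphere_iff_norm.mp hx
    rw [(hasGradientAt_fundSol hN (ne_of_mem_sphere hx hθ.ne')).gradient, hx', smul_smul,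
      neg_mul, ← mul_inv, mul_assoc, pow_sub_one_mul (by omega)]
  have hnorm : ∀ x ∈ sphere x₀ θ, ⟪θ⁻¹ • (x - x₀), θ⁻¹ • (x - x₀)⟫ = 1 := by
    intro x hx
    rw [real_inner_self_eq_norm_sq, norm_smul, mem_sphere_iff_norm.mp hx, norm_inv,
      Real.norm_of_nonneg hθ.le, inv_mul_cancel₀ hθ.ne', one_pow]
  have hflux : ∀ x ∈ sphere x₀ θ,
      ⟪gradient (fundSol x₀) x, θ⁻¹ • (x - x₀)⟫ = -(omegaN N * θ ^ (N - 1))⁻¹ := by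
    intro x hx
    rw [hgrad x hx, real_inner_smul_left, hnorm x hx, mul_one]
  have hI₁ : (∫ x in sphere x₀ θ, ⟪gradient (fundSol x₀) x, θ⁻¹ • (x - x₀)⟫ *
        ⟪gradient v x, θ⁻¹ • (x - x₀)⟫ ∂μH[(N : ℝ) - 1]) =
      -(omegaN N * θ ^ (N - 1))⁻¹ *
        ∫ x in sphere x₀ θ, ⟪gradient v x, θ⁻¹ • (x - x₀)⟫ ∂μH[(N : ℝ) - 1] := by
    rw [← integral_const_mul]
    exact setIntegral_congr_fun hs fun x hx => by simp only [hflux x hx]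
  have hI₂ : (∫ x in sphere x₀ θ, ⟪gradient (fundSol x₀) x, gradient v x⟫ ∂μH[(N : ℝ) - 1]) =
      -(omegaN N * θ ^ (N - 1))⁻¹ *
        ∫ x in sphere x₀ θ, ⟪gradient v x, θ⁻¹ • (x - x₀)⟫ ∂μH[(N : ℝ) - 1] := by
    rw [← integral_const_mul]
    refine setIntegral_congr_fun hs fun x hx => ?_
    simp only [hgrad x hx]
    rw [real_inner_smul_left, real_inner_comm]
  have hI₃ : (∫ x in sphere x₀ θ, ⟪gradient (fundSol x₀) x, θ⁻¹ • (x - x₀)⟫ * v x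
        ∂μH[(N : ℝ) - 1]) =
      -(omegaN N * θ ^ (N - 1))⁻¹ * ∫ x in sphere x₀ θ, v x ∂μH[(N : ℝ) - 1] := by
    rw [← integral_const_mul]
    exact setIntegral_congr_fun hs fun x hx => by simp only [hflux x hx]
  have hI₄ : (∫ x in sphere x₀ θ, ⟪gradient v x, θ⁻¹ • (x - x₀)⟫ * fundSol x₀ x
        ∂μH[(N : ℝ) - 1]) =
      (∫ x in sphere x₀ θ, ⟪gradient v x, θ⁻¹ • (x - x₀)⟫ ∂μH[(N : ℝ) - 1]) *
        (1 / (((N : ℝ) - 2) * omegaN N * θ ^ (N - 2))) := by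
    rw [← integral_mul_const]
    exact setIntegral_congr_fun hs fun x hx => by
      simp only [fundSol, mem_sphere_iff_norm.mp hx]
  rw [Pform, hI₁, hI₂, hI₃, hI₄]
  rw [setAverage_eq, setAverage_eq, hausdorffMeasure_real_sphere (by omega) x₀ hθ]
  obtain ⟨m, rfl⟩ := Nat.exists_eq_add_of_le' hN
  have hm : ((m + 3 : ℕ) : ℝ) - 2 = m + 1 := by push_cast; ring
  have hm' : 2 - ((m + 3 : ℕ) : ℝ) = -(m + 1) := by push_cast; ring
  rw [hm, hm', show m + 3 - 1 = m + 2 by omega, show m + 3 - 2 = m + 1 by omega]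
  simp only [smul_eq_mul]
  generalize (∫ x in sphere x₀ θ, v x ∂μH[((m + 3 : ℕ) : ℝ) - 1]) = J
  generalize (∫ x in sphere x₀ θ, ⟪gradient v x, θ⁻¹ • (x - x₀)⟫ ∂μH[((m + 3 : ℕ) : ℝ) - 1]) = I
  have hm'' : (m : ℝ) + 1 ≠ 0 := by positivity
  field_simp
  ring

theorem norm_setAverage_le_of_norm_le_const {α : Type*} [MeasurableSpace α] {μ : Measure α}
    {s : Set α} {f : α → ℝ} {C : ℝ} (h₀ : μ s ≠ 0) (ht : μ s ≠ ∞) (hf : ∀ x ∈ s, ‖f x‖ ≤ C) :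
    ‖⨍ x in s, f x ∂μ‖ ≤ C := by
  have hpos : 0 < μ.real s := ENNReal.toReal_pos h₀ ht
  rw [setAverage_eq, norm_smul, norm_inv, Real.norm_of_nonneg hpos.le, inv_mul_le_iff₀ hpos,
    mul_comm]
  exact norm_setIntegral_le_of_norm_le_const ht.lt_top hf

theorem hausdorffMeasure_sphere_ne_zero {N : ℕ} (hN : 1 ≤ N) (x₀ : EuclideanSpace ℝ (Fin N))
    {θ : ℝ} (hθ : 0 < θ) : μH[(N : ℝ) - 1] (sphere x₀ θ) ≠ 0 := by
  intro h
  have h' := hausdorffMeasure_real_sphere hN x₀ hθ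
  rw [measureReal_def, h, ENNReal.toReal_zero] at h'
  have := omegaN_pos hN
  exact absurd h' (by positivity)

theorem eventually_forall_mem_sphere {X : Type*} [PseudoMetricSpace X] {x₀ : X} {p : X → Prop}
    (hp : ∀ᶠ x in nhds x₀, p x) :
    ∀ᶠ θ in nhdsWithin (0 : ℝ) (Set.Ioi 0), ∀ x ∈ sphere x₀ θ, p x := by
  obtain ⟨ε, hε, h⟩ := Metric.eventually_nhds_iff_ball.mp hp
  filter_upwards [Ioo_mem_nhdsGT hε] with θ hθ x hx
  exact h x (sphere_subset_ball hθ.2 hx)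

theorem tendsto_setAverage_sphere {N : ℕ} (hN : 1 ≤ N) {x₀ : EuclideanSpace ℝ (Fin N)}
    {f : EuclideanSpace ℝ (Fin N) → ℝ} (hf : ∀ᶠ x in nhds x₀, ContinuousAt f x) :
    Filter.Tendsto (fun θ : ℝ => ⨍ x in sphere x₀ θ, f x ∂μH[(N : ℝ) - 1])
      (nhdsWithin 0 (Set.Ioi 0)) (nhds (f x₀)) := by
  rw [Metric.tendsto_nhds]
  intro ε hε
  have hclose := eventually_forall_mem_sphere
    (Metric.tendsto_nhds.mp hf.self_of_nhds (ε / 2) (half_pos hε))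
  filter_upwards [hclose, eventually_forall_mem_sphere hf, self_mem_nhdsWithin]
    with θ hθ hcont hpos
  have h₀ := hausdorffMeasure_sphere_ne_zero hN x₀ hpos
  have ht := (hausdorffMeasure_sphere_lt_top hN x₀ hpos).ne
  have hint : IntegrableOn f (sphere x₀ θ) μH[(N : ℝ) - 1] :=
    ContinuousOn.integrableOn_of_subset_isCompact
      (fun x hx => (hcont x hx).continuousWithinAt) (isCompact_sphere x₀ θ)
      isClosed_sphere.measurableSet subset_rfl ht
  have hsub : (⨍ x in sphere x₀ θ, f x ∂μH[(N : ℝ) - 1]) - f x₀ =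
      ⨍ x in sphere x₀ θ, (f x - f x₀) ∂μH[(N : ℝ) - 1] := by
    rw [setAverage_eq, setAverage_eq, integral_sub hint (integrableOn_const ht),
      setIntegral_const, smul_sub, smul_smul,
      inv_mul_cancel₀ ((measureReal_ne_zero_iff ht).mpr h₀), one_smul]
  rw [dist_eq_norm, hsub]
  refine (norm_setAverage_le_of_norm_le_const h₀ ht fun x hx => ?_).trans_lt (half_lt_self hε)
  rw [← dist_eq_norm]
  exact (hθ x hx).le

/-- If `Φ` is `C¹` on an open neighborhood of `x₀`, then
`P_θ(S_{x₀}, Φ) → ((N-2)/4) Φ(x₀)` as `θ → 0⁺`. -/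
theorem Pform_fundSol_smooth_limit {N : ℕ} (hN : 3 ≤ N)
    (x₀ : EuclideanSpace ℝ (Fin N)) (Φ : EuclideanSpace ℝ (Fin N) → ℝ)
    (V : Set (EuclideanSpace ℝ (Fin N))) (hV : IsOpen V) (hx₀ : x₀ ∈ V)
    (hΦ : ContDiffOn ℝ 1 Φ V) :
    Filter.Tendsto (fun θ : ℝ => Pform x₀ θ (fundSol x₀) Φ)
      (nhdsWithin 0 (Set.Ioi 0)) (nhds ((((N : ℝ) - 2) / 4) * Φ x₀)) := by
  have hN₁ : 1 ≤ N := by omega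
  have hcont : ∀ᶠ x in nhds x₀, ContinuousAt Φ x := by
    filter_upwards [hV.mem_nhds hx₀] with x hx
    exact hΦ.continuousOn.continuousAt (hV.mem_nhds hx)
  have hgrad : ContinuousAt (fderiv ℝ Φ) x₀ :=
    (hΦ.continuousOn_fderiv_of_isOpen hV le_rfl).continuousAt (hV.mem_nhds hx₀)
  have hbound : ∀ᶠ x in nhds x₀, ‖fderiv ℝ Φ x‖ < ‖fderiv ℝ Φ x₀‖ + 1 :=
    hgrad.norm.eventually_lt_const (lt_add_one _)
  have hflux : Filter.Tendsto (fun θ : ℝ => θ / 4 *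
      ⨍ x in sphere x₀ θ, ⟪gradient Φ x, θ⁻¹ • (x - x₀)⟫ ∂μH[(N : ℝ) - 1])
      (nhdsWithin 0 (Set.Ioi 0)) (nhds 0) := by
    have hid : Filter.Tendsto (fun θ : ℝ => θ / 4) (nhdsWithin 0 (Set.Ioi 0)) (nhds 0) := by
      have : Filter.Tendsto (fun θ : ℝ => θ / 4) (nhds 0) (nhds (0 / 4)) :=
        Filter.tendsto_id.div_const 4
      rw [zero_div] at this
      exact this.mono_left nhdsWithin_le_nhds
    refine hid.zero_mul_isBoundedUnder_le (Filter.isBoundedUnder_of_eventually_le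
      (a := ‖fderiv ℝ Φ x₀‖ + 1) ?_)
    filter_upwards [eventually_forall_mem_sphere hbound, self_mem_nhdsWithin] with θ hθ hpos
    have hpos' : 0 < θ := hpos
    refine norm_setAverage_le_of_norm_le_const (hausdorffMeasure_sphere_ne_zero hN₁ x₀ hpos)
      (hausdorffMeasure_sphere_lt_top hN₁ x₀ hpos).ne fun x hx => ?_
    have hν : ‖θ⁻¹ • (x - x₀)‖ = 1 := by
      rw [norm_smul, mem_sphere_iff_norm.mp hx, norm_inv, Real.norm_of_nonneg hpos'.le,
        inv_mul_cancel₀ hpos'.ne']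
    rw [inner_gradient_left]
    calc _ ≤ ‖fderiv ℝ Φ x‖ * ‖θ⁻¹ • (x - x₀)‖ := (fderiv ℝ Φ x).le_opNorm _
      _ ≤ _ := by rw [hν, mul_one]; exact (hθ x hx).le
  have hlim := hflux.add ((tendsto_setAverage_sphere hN₁ hcont).const_mul (((N : ℝ) - 2) / 4))
  rw [zero_add] at hlim
  refine hlim.congr' ?_
  filter_upwards [self_mem_nhdsWithin] with θ hθ
  exact (Pform_fundSol_eq hN x₀ hθ Φ).symm
end

section
/- Let N ≥ 3 be an integer, x₀ ∈ ℝ^N, i, h ∈ {1,…,N}, and W_{x₀,h}(x) := (x_h − (x₀)_h)/(ω_N |x−x₀|^N) (the partial derivative with respect to the h-th coordinate of the pole x₀ of the fundamental solution S_{x₀}(x) = 1/((N−2)ω_N |x−x₀|^{N−2})). Let Φ be a real function that is harmonic on an open ball B_d(x₀) for some d > 0. Then lim_{θ→0⁺} Q_{θ,i}(Φ, W_{x₀,h}) = (∂²Φ/∂x_i∂x_h)(x₀). -/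
open MeasureTheory Metric Real
open scoped RealInnerProductSpace ENNReal

/-- The unit sphere in `ℝ^(n+1)` has finite `n`-dimensional Hausdorff measure. -/
theorem hausdorffMeasure_unitSphere_lt_top_s16 (n : ℕ) :
    μH[(n : ℝ)] (sphere (0 : EuclideanSpace ℝ (Fin (n + 1))) 1) < ⊤ := by
  let face : Fin (n + 1) → ℝ → (Fin n → ℝ) → EuclideanSpace ℝ (Fin (n + 1)) :=
    fun j c t => WithLp.toLp 2 (j.insertNth c t)
  let cube : Set (Fin n → ℝ) := Set.Icc (fun _ => -1) (fun _ => 1)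
  let proj : Fin (n + 1) → ℝ → (Fin n → ℝ) → EuclideanSpace ℝ (Fin (n + 1)) :=
    fun j c t => ‖face j c t‖⁻¹ • face j c t
  have face_smooth (j : Fin (n + 1)) (c : ℝ) : ContDiff ℝ 1 (face j c) := by
    refine contDiff_euclidean.2 fun k => ?_
    rcases Fin.eq_self_or_eq_succAbove j k with rfl | ⟨l, rfl⟩
    · simpa [face] using contDiff_const
    · simpa [face] using contDiff_apply ℝ ℝ l
  have proj_finite (j : Fin (n + 1)) (c : ℝ) (hc : c ≠ 0) : μH[(n : ℝ)] (proj j c '' cube) < ⊤ := by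
    have hne (t : Fin n → ℝ) : face j c t ≠ 0 := fun h0 => hc (by
      simpa [face] using congrArg (fun z : EuclideanSpace ℝ (Fin (n + 1)) => z j) h0)
    have hproj : ContDiff ℝ 1 (proj j c) :=
      (((face_smooth j c).norm ℝ hne).inv fun t => norm_ne_zero_iff.2 (hne t)).smul
        (face_smooth j c)
    obtain ⟨K, hK⟩ := hproj.locallyLipschitz.locallyLipschitzOn.exists_lipschitzOnWith_of_compact
      (isCompact_Icc : IsCompact cube)
    refine (hK.hausdorffMeasure_image_le n.cast_nonneg).trans_lt ?_
    refine ENNReal.mul_lt_top (ENNReal.rpow_lt_top_of_nonneg n.cast_nonneg ENNReal.coe_ne_top) ?_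
    have hvol := hausdorffMeasure_pi_real (ι := Fin n)
    rw [Fintype.card_fin] at hvol
    rw [hvol]
    exact (isCompact_Icc : IsCompact cube).measure_lt_top
  have cover : sphere (0 : EuclideanSpace ℝ (Fin (n + 1))) 1 ⊆
      ⋃ j, (proj j 1 '' cube ∪ proj j (-1) '' cube) := by
    intro z hz
    have hz1 : ‖z‖ = 1 := by simpa using hz
    obtain ⟨j, hj⟩ := Finite.exists_max fun k => |z k|
    have hzj : 0 < |z j| := by
      refine abs_pos.2 fun h0 => ?_
      have : z = 0 := by
        ext k
        simpa [h0] using hj k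
      simp [this] at hz1
    have hcube : (fun l => z (j.succAbove l) / |z j|) ∈ cube := by
      constructor <;> intro l <;> simp only
      · rw [le_div_iff₀ hzj]
        linarith [neg_abs_le (z (j.succAbove l)), hj (j.succAbove l)]
      · rw [div_le_iff₀ hzj]
        linarith [le_abs_self (z (j.succAbove l)), hj (j.succAbove l)]
    have hproj (c : ℝ) (hc : c * |z j| = z j) :
        proj j c (fun l => z (j.succAbove l) / |z j|) = z := by
      have hface : face j c (fun l => z (j.succAbove l) / |z j|) = |z j|⁻¹ • z := by
        ext k
        rcases Fin.eq_self_or_eq_succAbove j k with rfl | ⟨l, rfl⟩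
        · simp only [face, Fin.insertNth_apply_same, PiLp.smul_apply, smul_eq_mul]
          field_simp
          exact hc
        · simp [face, div_eq_inv_mul]
      simp only [proj, hface, norm_smul, hz1, smul_smul]
      rw [norm_inv, Real.norm_eq_abs, abs_abs, mul_one, inv_inv, mul_inv_cancel₀ hzj.ne', one_smul]
    refine Set.mem_iUnion.2 ⟨j, ?_⟩
    rcases abs_cases (z j) with ⟨habs, -⟩ | ⟨habs, -⟩
    · exact Or.inl ⟨_, hcube, hproj 1 (by linarith)⟩
    · exact Or.inr ⟨_, hcube, hproj (-1) (by linarith)⟩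
  refine (measure_mono cover).trans_lt ((measure_iUnion_fintype_le _ _).trans_lt ?_)
  exact ENNReal.sum_lt_top.2 fun j _ => (measure_union_le _ _).trans_lt
    (ENNReal.add_lt_top.2 ⟨proj_finite j 1 one_ne_zero, proj_finite j (-1) (by norm_num)⟩)

/-- The unit sphere in `ℝ^(n+1)` has positive `n`-dimensional Hausdorff measure. -/
theorem hausdorffMeasure_unitSphere_pos_s16 (n : ℕ) :
    0 < μH[(n : ℝ)] (sphere (0 : EuclideanSpace ℝ (Fin (n + 1))) 1) := by
  let dropZero : EuclideanSpace ℝ (Fin (n + 1)) → (Fin n → ℝ) := fun z l => z l.succ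
  have hdrop : LipschitzWith 1 dropZero := by
    refine LipschitzWith.of_dist_le_mul fun z w => ?_
    rw [NNReal.coe_one, one_mul, dist_eq_norm, dist_eq_norm]
    refine (pi_norm_le_iff_of_nonneg (norm_nonneg _)).2 fun l => ?_
    exact PiLp.norm_apply_le (z - w) l.succ
  let U : Set (Fin n → ℝ) := {t | ∑ l, t l ^ 2 < 1}
  have hU : U ⊆ dropZero '' sphere 0 1 := by
    intro t ht
    refine ⟨WithLp.toLp 2 (Fin.cons (√(1 - ∑ l, t l ^ 2)) t), ?_, ?_⟩
    · have h0 : 0 ≤ 1 - ∑ l, t l ^ 2 := sub_nonneg.2 (le_of_lt ht)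
      rw [mem_sphere_zero_iff_norm, EuclideanSpace.norm_eq, Fin.sum_univ_succ]
      simp [Real.sq_sqrt h0]
    · ext l
      simp [dropZero]
  have hUpos : 0 < μH[(n : ℝ)] U := by
    have hvol := hausdorffMeasure_pi_real (ι := Fin n)
    rw [Fintype.card_fin] at hvol
    rw [hvol]
    refine IsOpen.measure_pos _ (isOpen_lt (by fun_prop) continuous_const) ⟨0, ?_⟩
    simp [U]
  have hle := hdrop.hausdorffMeasure_image_le (n.cast_nonneg : (0 : ℝ) ≤ n) (sphere 0 1)
  rw [ENNReal.coe_one, ENNReal.one_rpow, one_mul] at hle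
  exact hUpos.trans_le ((measure_mono hU).trans hle)

theorem hausdorffMeasure_unitSphere_ne_top {N : ℕ} (hN : 1 ≤ N) :
    μH[(N : ℝ) - 1] (sphere (0 : EuclideanSpace ℝ (Fin N)) 1) ≠ ⊤ := by
  obtain ⟨n, rfl⟩ := Nat.exists_eq_add_of_le' hN
  simpa using (hausdorffMeasure_unitSphere_lt_top_s16 n).ne

theorem setIntegral_sphere_eq_unitSphere {E : Type*} [NormedAddCommGroup E] [NormedSpace ℝ E]
    [MeasurableSpace E] [BorelSpace E] {s : ℝ} (hs : 0 ≤ s) (x₀ : E) {θ : ℝ} (hθ : 0 < θ)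
    (F : E → ℝ) :
    ∫ x in sphere x₀ θ, F x ∂μH[s] = θ ^ s * ∫ z in sphere (0 : E) 1, F (x₀ + θ • z) ∂μH[s] := by
  let e : E ≃ₜ E := (Homeomorph.smulOfNeZero θ hθ.ne').trans (Homeomorph.addLeft x₀)
  have he (z : E) : e z = x₀ + θ • z := rfl
  have hmap : Measure.map e μH[s] = ‖θ‖₊⁻¹ ^ s • (μH[s] : Measure E) := by
    have hhom := map_homothety_hausdorffMeasure (P := E) hs (0 : E) hθ.ne'
    have hcomp : (e : E → E) = (fun y => x₀ + y) ∘ AffineMap.homothety (0 : E) θ := by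
      ext z
      simp [he, AffineMap.homothety_apply]
    rw [hcomp, ← Measure.map_map (by fun_prop) (AffineMap.homothety_continuous _ _).measurable,
      hhom, Measure.map_smul, map_add_left_eq_self]
  have hpre : e ⁻¹' sphere x₀ θ = sphere 0 1 := by
    ext z
    simp [he, norm_smul, abs_of_pos hθ, hθ.ne']
  have hint := e.measurableEmbedding.setIntegral_map (μ := μH[s]) F (sphere x₀ θ)
  rw [hmap, hpre, Measure.restrict_smul, integral_smul_nnreal_measure] at hint
  simp only [he] at hint
  rw [← hint, NNReal.smul_def, smul_eq_mul, ← mul_assoc, NNReal.coe_rpow, NNReal.coe_inv,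
    coe_nnnorm, Real.norm_of_nonneg hθ.le, Real.inv_rpow hθ.le,
    mul_inv_cancel₀ (Real.rpow_pos_of_pos hθ s).ne', one_mul]

theorem setIntegral_unitSphere_comp_isometry {E : Type*} [NormedAddCommGroup E]
    [NormedSpace ℝ E] [MeasurableSpace E] [BorelSpace E] (s : ℝ) (L : E ≃ₗᵢ[ℝ] E) (F : E → ℝ) :
    ∫ z in sphere (0 : E) 1, F (L z) ∂μH[s] = ∫ z in sphere (0 : E) 1, F z ∂μH[s] := by
  have hpre : L ⁻¹' sphere (0 : E) 1 = sphere 0 1 := by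
    ext z
    simp
  have hmp : MeasurePreserving L (μH[s] : Measure E) μH[s] :=
    L.toIsometryEquiv.measurePreserving_hausdorffMeasure s
  have := hmp.setIntegral_preimage_emb L.toHomeomorph.measurableEmbedding F (sphere 0 1)
  rwa [hpre] at this

theorem integrableOn_unitSphere {N : ℕ} (hN : 1 ≤ N) {F : EuclideanSpace ℝ (Fin N) → ℝ}
    (hF : ContinuousOn F (sphere 0 1)) : IntegrableOn F (sphere 0 1) μH[(N : ℝ) - 1] :=
  hF.integrableOn_of_subset_isCompact (isCompact_sphere _ _) isClosed_sphere.measurableSet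
    Set.Subset.rfl (hausdorffMeasure_unitSphere_ne_top hN)

theorem setIntegral_unitSphere_coord {N : ℕ} (a : Fin N) :
    ∫ z in sphere (0 : EuclideanSpace ℝ (Fin N)) 1, z a ∂μH[(N : ℝ) - 1] = 0 := by
  have h := setIntegral_unitSphere_comp_isometry ((N : ℝ) - 1)
    (LinearIsometryEquiv.neg ℝ (E := EuclideanSpace ℝ (Fin N))) (fun z => z a)
  simp only [LinearIsometryEquiv.coe_neg, PiLp.neg_apply, integral_neg] at h
  linarith

theorem setIntegral_unitSphere_coord_mul_coord {N : ℕ} (hN : 1 ≤ N) (a b : Fin N) :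
    ∫ z in sphere (0 : EuclideanSpace ℝ (Fin N)) 1, z a * z b ∂μH[(N : ℝ) - 1] =
      if a = b then omegaN N / N else 0 := by
  split_ifs with hab
  · subst hab
    have hswap (c : Fin N) :
        ∫ z in sphere (0 : EuclideanSpace ℝ (Fin N)) 1, z c * z c ∂μH[(N : ℝ) - 1] =
        ∫ z in sphere (0 : EuclideanSpace ℝ (Fin N)) 1, z a * z a ∂μH[(N : ℝ) - 1] := by
      have h := setIntegral_unitSphere_comp_isometry ((N : ℝ) - 1)
        (LinearIsometryEquiv.piLpCongrLeft 2 ℝ ℝ (Equiv.swap a c)) (fun z => z a * z a)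
      simpa [LinearIsometryEquiv.piLpCongrLeft_apply, Equiv.piCongrLeft'] using h
    have hsum : ∑ c : Fin N,
        ∫ z in sphere (0 : EuclideanSpace ℝ (Fin N)) 1, z c * z c ∂μH[(N : ℝ) - 1] = omegaN N := by
      rw [← integral_finsetSum _ fun c _ => integrableOn_unitSphere hN (by fun_prop)]
      rw [setIntegral_congr_fun isClosed_sphere.measurableSet (g := fun _ => (1 : ℝ))]
      · simp [omegaN, Measure.real]
      · intro z hz
        have hz1 : ‖z‖ ^ 2 = 1 := by simp [mem_sphere_zero_iff_norm.1 hz]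
        rw [EuclideanSpace.real_norm_sq_eq] at hz1
        simpa only [sq] using hz1
    simp only [hswap, Finset.sum_const, Finset.card_univ, Fintype.card_fin, nsmul_eq_mul] at hsum
    have : (N : ℝ) ≠ 0 := by positivity
    rw [eq_div_iff this]
    linarith
  · let flip : EuclideanSpace ℝ (Fin N) ≃ₗᵢ[ℝ] EuclideanSpace ℝ (Fin N) :=
      LinearIsometryEquiv.piLpCongrRight 2 fun c =>
        if c = a then LinearIsometryEquiv.neg ℝ else LinearIsometryEquiv.refl ℝ ℝ
    have h := setIntegral_unitSphere_comp_isometry ((N : ℝ) - 1) flip (fun z => z a * z b)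
    simp only [flip, LinearIsometryEquiv.piLpCongrRight_apply, if_true, Ne.symm hab, if_false,
      LinearIsometryEquiv.coe_neg, LinearIsometryEquiv.coe_refl, id, neg_mul, integral_neg] at h
    linarith

theorem clm_apply_eq_sum_coord {N : ℕ} (L : EuclideanSpace ℝ (Fin N) →L[ℝ] ℝ)
    (v : EuclideanSpace ℝ (Fin N)) : L v = ∑ a, v a * L (EuclideanSpace.single a 1) := by
  conv_lhs => rw [← (EuclideanSpace.basisFun (Fin N) ℝ).sum_repr v]
  simp

theorem continuousOn_coord {N : ℕ} (a : Fin N) (s : Set (EuclideanSpace ℝ (Fin N))) :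
    ContinuousOn (fun z : EuclideanSpace ℝ (Fin N) => z a) s :=
  (EuclideanSpace.proj a : EuclideanSpace ℝ (Fin N) →L[ℝ] ℝ).continuous.continuousOn

theorem fderiv_poleDeriv_apply {N : ℕ} (hN : 2 ≤ N) (x₀ : EuclideanSpace ℝ (Fin N)) (h : Fin N)
    {θ : ℝ} (hθ : 0 < θ) {z : EuclideanSpace ℝ (Fin N)} (hz : ‖z‖ = 1)
    (v : EuclideanSpace ℝ (Fin N)) :
    fderiv ℝ (poleDeriv x₀ h) (x₀ + θ • z) v =
      (omegaN N)⁻¹ * (θ ^ N)⁻¹ * (v h - N * z h * ⟪z, v⟫) := by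
  have hω : omegaN N ≠ 0 := (omegaN_pos (by omega)).ne'
  have hnorm : ‖(x₀ + θ • z) - x₀‖ = θ := by
    simp [norm_smul, hz, abs_of_pos hθ]
  have hpow : HasFDerivAt (fun x : EuclideanSpace ℝ (Fin N) => omegaN N * ‖x - x₀‖ ^ N)
      (omegaN N • ((N * θ ^ ((N : ℝ) - 2)) • innerSL ℝ (θ • z))) (x₀ + θ • z) := by
    have hrpow := (hasFDerivAt_norm_rpow ((x₀ + θ • z) - x₀)
      (p := N) (by exact_mod_cast hN)).comp (x₀ + θ • z)
      ((hasFDerivAt_id (𝕜 := ℝ) (x₀ + θ • z)).sub_const x₀)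
    rw [hnorm, add_sub_cancel_left, ContinuousLinearMap.comp_id] at hrpow
    refine HasFDerivAt.const_mul (hrpow.congr_of_eventuallyEq (.of_forall fun x => ?_)) _
    simp [Real.rpow_natCast]
  have hcoord : HasFDerivAt (fun x : EuclideanSpace ℝ (Fin N) => x h - x₀ h)
      (EuclideanSpace.proj h : EuclideanSpace ℝ (Fin N) →L[ℝ] ℝ) (x₀ + θ • z) :=
    ((EuclideanSpace.proj h : EuclideanSpace ℝ (Fin N) →L[ℝ] ℝ).hasFDerivAt).sub_const _
  have hden : omegaN N * ‖(x₀ + θ • z) - x₀‖ ^ N ≠ 0 := by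
    rw [hnorm]
    positivity
  have hdiv := hcoord.mul ((hasDerivAt_inv hden).comp_hasFDerivAt (x₀ + θ • z) hpow)
  have hW : HasFDerivAt (poleDeriv x₀ h) _ (x₀ + θ • z) :=
    hdiv.congr_of_eventuallyEq (.of_forall fun x => by simp [poleDeriv, div_eq_mul_inv])
  have hθN : θ ^ ((N : ℝ) - 2) * θ * θ = θ ^ N := by
    rw [Real.rpow_sub hθ, Real.rpow_natCast, Real.rpow_two]
    field_simp
  have hproj : (EuclideanSpace.proj h : EuclideanSpace ℝ (Fin N) →L[ℝ] ℝ) v = v h := rfl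
  rw [hW.fderiv]
  simp only [add_apply, smul_apply, smul_eq_mul, Function.comp_apply, hnorm, hproj]
  simp only [PiLp.add_apply, PiLp.smul_apply, smul_eq_mul, add_sub_cancel_left,
    innerSL_apply_apply, real_inner_smul_left]
  rw [← hθN]
  have := Real.rpow_pos_of_pos hθ ((N : ℝ) - 2)
  field_simp
  ring

theorem tendsto_inv_mul_setIntegral_unitSphere {N : ℕ} (hN : 1 ≤ N)
    {x₀ : EuclideanSpace ℝ (Fin N)} {p : EuclideanSpace ℝ (Fin N) → ℝ} {d : ℝ} (hd : 0 < d)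
    (hpc : ContinuousOn p (ball x₀ d)) (hpd : DifferentiableAt ℝ p x₀) (a : Fin N) :
    Filter.Tendsto (fun θ : ℝ => θ⁻¹ *
        ∫ z in sphere (0 : EuclideanSpace ℝ (Fin N)) 1, z a * p (x₀ + θ • z) ∂μH[(N : ℝ) - 1])
      (nhdsWithin 0 (Set.Ioi 0))
      (nhds (omegaN N / N * fderiv ℝ p x₀ (EuclideanSpace.single a 1))) := by
  have hmem (θ : ℝ) (hθ : θ ∈ Set.Ioo 0 d) (z : EuclideanSpace ℝ (Fin N))
      (hz : z ∈ sphere (0 : EuclideanSpace ℝ (Fin N)) 1) : x₀ + θ • z ∈ ball x₀ d := by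
    simpa [norm_smul, mem_sphere_zero_iff_norm.1 hz, abs_of_pos hθ.1] using hθ.2
  have hcont (θ : ℝ) (hθ : θ ∈ Set.Ioo 0 d) : ContinuousOn
      (fun z : EuclideanSpace ℝ (Fin N) => p (x₀ + θ • z)) (sphere 0 1) :=
    hpc.comp (by fun_prop) (hmem θ hθ)
  have hsmall : ∀ᶠ θ : ℝ in nhdsWithin 0 (Set.Ioi 0), θ ∈ Set.Ioo 0 d :=
    Ioo_mem_nhdsGT hd
  have hlim : ∫ z in sphere (0 : EuclideanSpace ℝ (Fin N)) 1, z a * fderiv ℝ p x₀ z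
      ∂μH[(N : ℝ) - 1] = omegaN N / N * fderiv ℝ p x₀ (EuclideanSpace.single a 1) := by
    have hexp (z : EuclideanSpace ℝ (Fin N)) : z a * fderiv ℝ p x₀ z =
        ∑ b, z a * z b * fderiv ℝ p x₀ (EuclideanSpace.single b 1) := by
      rw [clm_apply_eq_sum_coord, Finset.mul_sum]
      simp only [mul_assoc]
    simp_rw [hexp]
    rw [integral_finsetSum _ fun b _ => integrableOn_unitSphere hN (by fun_prop)]
    simp_rw [integral_mul_const, setIntegral_unitSphere_coord_mul_coord hN]
    simp
  rw [← hlim]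
  have hDCT : Filter.Tendsto (fun θ : ℝ =>
      ∫ z in sphere (0 : EuclideanSpace ℝ (Fin N)) 1, z a * (θ⁻¹ * (p (x₀ + θ • z) - p x₀))
        ∂μH[(N : ℝ) - 1]) (nhdsWithin 0 (Set.Ioi 0))
      (nhds (∫ z in sphere (0 : EuclideanSpace ℝ (Fin N)) 1, z a * fderiv ℝ p x₀ z
        ∂μH[(N : ℝ) - 1])) := by
    obtain ⟨C, hC⟩ := hpd.hasFDerivAt.isBigO_sub.bound
    obtain ⟨r, hr, hCr⟩ := Metric.eventually_nhds_iff_ball.1 hC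
    have hsmall' : ∀ᶠ θ : ℝ in nhdsWithin 0 (Set.Ioi 0), θ ∈ Set.Ioo 0 r :=
      Ioo_mem_nhdsGT hr
    refine tendsto_integral_filter_of_dominated_convergence (fun _ => C) ?_ ?_ ?_ ?_
    · filter_upwards [hsmall] with θ hθ
      exact (integrableOn_unitSphere hN ((continuousOn_coord a _).mul
        (continuousOn_const.mul ((hcont θ hθ).sub continuousOn_const)))).aestronglyMeasurable
    · filter_upwards [hsmall'] with θ hθ
      filter_upwards [ae_restrict_mem isClosed_sphere.measurableSet] with z hz
      have hz1 := mem_sphere_zero_iff_norm.1 hz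
      have hb := hCr (x₀ + θ • z) (by simpa [norm_smul, hz1, abs_of_pos hθ.1] using hθ.2)
      rw [add_sub_cancel_left, norm_smul, hz1, mul_one, Real.norm_of_nonneg hθ.1.le] at hb
      have hza : ‖z a‖ ≤ 1 := (PiLp.norm_apply_le z a).trans_eq hz1
      rw [norm_mul, norm_mul, norm_inv, Real.norm_of_nonneg hθ.1.le]
      refine (mul_le_of_le_one_left (by have := hθ.1; positivity) hza).trans ?_
      rw [inv_mul_le_iff₀ hθ.1]
      linarith
    · exact integrableOn_unitSphere hN continuousOn_const
    · refine .of_forall fun z => Filter.Tendsto.const_mul _ ?_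
      have hline := (hpd.hasFDerivAt.hasLineDerivAt z).tendsto_slope_zero_right
      simpa using hline
  refine hDCT.congr' ?_
  filter_upwards [hsmall] with θ hθ
  have hint : IntegrableOn (fun z : EuclideanSpace ℝ (Fin N) => z a * p (x₀ + θ • z))
      (sphere 0 1) μH[(N : ℝ) - 1] := 
    integrableOn_unitSphere hN ((continuousOn_coord a _).mul (hcont θ hθ))
  have hint' : IntegrableOn (fun z : EuclideanSpace ℝ (Fin N) => z a * p x₀)
      (sphere 0 1) μH[(N : ℝ) - 1] := integrableOn_unitSphere hN (by fun_prop)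
  calc _ = ∫ z in sphere (0 : EuclideanSpace ℝ (Fin N)) 1,
        θ⁻¹ * (z a * p (x₀ + θ • z) - z a * p x₀) ∂μH[(N : ℝ) - 1] := by
        congr 1 with z
        ring
    _ = _ := by
        rw [integral_const_mul, integral_sub hint hint', integral_mul_const,
          setIntegral_unitSphere_coord, zero_mul, sub_zero]

theorem Qform_poleDeriv_eq {N : ℕ} (hN : 2 ≤ N) (x₀ : EuclideanSpace ℝ (Fin N)) (i h : Fin N)
    {θ : ℝ} (hθ : 0 < θ) {Φ : EuclideanSpace ℝ (Fin N) → ℝ}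
    (hΦ : ∀ v, ContinuousOn (fun x => fderiv ℝ Φ x v) (sphere x₀ θ)) :
    Qform x₀ θ i Φ (poleDeriv x₀ h) = (omegaN N)⁻¹ *
      (((N : ℝ) - 1) * (θ⁻¹ * ∫ z in sphere (0 : EuclideanSpace ℝ (Fin N)) 1,
          z h * fderiv ℝ Φ (x₀ + θ • z) (EuclideanSpace.single i 1) ∂μH[(N : ℝ) - 1])
        + θ⁻¹ * ∫ z in sphere (0 : EuclideanSpace ℝ (Fin N)) 1,
          z i * fderiv ℝ Φ (x₀ + θ • z) (EuclideanSpace.single h 1) ∂μH[(N : ℝ) - 1]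
        - (if i = h then 1 else 0) * ∑ a, θ⁻¹ * ∫ z in sphere (0 : EuclideanSpace ℝ (Fin N)) 1,
          z a * fderiv ℝ Φ (x₀ + θ • z) (EuclideanSpace.single a 1) ∂μH[(N : ℝ) - 1]) := by
  have hN1 : 1 ≤ N := by omega
  have hs : (0 : ℝ) ≤ N - 1 := sub_nonneg.2 (by exact_mod_cast hN1)
  let D : EuclideanSpace ℝ (Fin N) → Fin N → ℝ :=
    fun z a => fderiv ℝ Φ (x₀ + θ • z) (EuclideanSpace.single a 1)
  have hD (a : Fin N) : ContinuousOn (fun z => D z a) (sphere 0 1) := by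
    refine (hΦ (EuclideanSpace.single a 1)).comp (f := fun z => x₀ + θ • z) (by fun_prop) ?_
    intro z hz
    simp [norm_smul, mem_sphere_zero_iff_norm.1 hz, abs_of_pos hθ]
  have hX (a : Fin N) := continuousOn_coord a (sphere (0 : EuclideanSpace ℝ (Fin N)) 1)
  have hfderiv (z v : EuclideanSpace ℝ (Fin N)) :
      fderiv ℝ Φ (x₀ + θ • z) v = ∑ a, v a * D z a :=
    clm_apply_eq_sum_coord _ v
  have hθpow : θ ^ ((N : ℝ) - 1) * (θ ^ N)⁻¹ = θ⁻¹ := by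
    rw [Real.rpow_sub hθ, Real.rpow_natCast, Real.rpow_one]
    field_simp
  have hnormal (z : EuclideanSpace ℝ (Fin N)) : θ⁻¹ • (x₀ + θ • z - x₀) = z := by
    rw [add_sub_cancel_left, inv_smul_smul₀ hθ.ne']
  have hcoord (z : EuclideanSpace ℝ (Fin N)) : (x₀ + θ • z - x₀) i / θ = z i := by
    rw [add_sub_cancel_left, PiLp.smul_apply, smul_eq_mul, mul_div_cancel_left₀ _ hθ.ne']
  have hself (z : EuclideanSpace ℝ (Fin N)) (hz : ‖z‖ = 1) : ⟪z, z⟫ = 1 := by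
    rw [real_inner_self_eq_norm_sq, hz, one_pow]
  have hnormalW (z : EuclideanSpace ℝ (Fin N)) (hz : ‖z‖ = 1) :
      fderiv ℝ (poleDeriv x₀ h) (x₀ + θ • z) z =
        (omegaN N)⁻¹ * (θ ^ N)⁻¹ * ((1 - N) * z h) := by
    rw [fderiv_poleDeriv_apply hN x₀ h hθ hz, hself z hz]
    ring
  have hpartialW (z : EuclideanSpace ℝ (Fin N)) (hz : ‖z‖ = 1) :
      fderiv ℝ (poleDeriv x₀ h) (x₀ + θ • z) (EuclideanSpace.single i 1) =
        (omegaN N)⁻¹ * (θ ^ N)⁻¹ * ((if i = h then 1 else 0) - N * z h * z i) := by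
    rw [fderiv_poleDeriv_apply hN x₀ h hθ hz]
    simp [eq_comm, EuclideanSpace.inner_single_right]
  have hgradW (z : EuclideanSpace ℝ (Fin N)) (hz : ‖z‖ = 1) :
      ⟪gradient Φ (x₀ + θ • z), gradient (poleDeriv x₀ h) (x₀ + θ • z)⟫ =
        (omegaN N)⁻¹ * (θ ^ N)⁻¹ * (D z h - N * z h * ∑ a, z a * D z a) := by
    rw [real_inner_comm, inner_gradient_left, fderiv_poleDeriv_apply hN x₀ h hθ hz,
      ← hfderiv z z, ← inner_gradient_left (f := Φ), real_inner_comm z]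
    congr 2
    simp only [D]
    rw [← inner_gradient_left (f := Φ), EuclideanSpace.inner_single_right]
    simp
  let c : ℝ := (omegaN N)⁻¹ * (θ ^ N)⁻¹
  let δ : ℝ := if i = h then 1 else 0
  let μ : Measure (EuclideanSpace ℝ (Fin N)) := (μH[(N : ℝ) - 1]).restrict (sphere 0 1)
  have hint {F : EuclideanSpace ℝ (Fin N) → ℝ} (hF : ContinuousOn F (sphere 0 1)) :
      Integrable F μ := integrableOn_unitSphere hN1 hF
  have hmeas : MeasurableSet (sphere (0 : EuclideanSpace ℝ (Fin N)) 1) :=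
    isClosed_sphere.measurableSet
  have hfirst : ∫ z, ⟪gradient (poleDeriv x₀ h) (x₀ + θ • z), θ⁻¹ • (x₀ + θ • z - x₀)⟫ *
        fderiv ℝ Φ (x₀ + θ • z) (EuclideanSpace.single i 1) ∂μ =
      ∫ z, c * ((1 - N) * z h) * D z i ∂μ := by
    refine setIntegral_congr_fun hmeas fun z hz => ?_
    simp only [hnormal, inner_gradient_left, hnormalW z (mem_sphere_zero_iff_norm.1 hz), D, c]
  have hsecond : ∫ z, ⟪gradient Φ (x₀ + θ • z), θ⁻¹ • (x₀ + θ • z - x₀)⟫ *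
        fderiv ℝ (poleDeriv x₀ h) (x₀ + θ • z) (EuclideanSpace.single i 1) ∂μ =
      ∫ z, (∑ a, z a * D z a) * (c * (δ - N * z h * z i)) ∂μ := by
    refine setIntegral_congr_fun hmeas fun z hz => ?_
    simp only [hnormal, inner_gradient_left, hfderiv z z,
      hpartialW z (mem_sphere_zero_iff_norm.1 hz), c, δ]
  have hthird : ∫ z, ⟪gradient Φ (x₀ + θ • z), gradient (poleDeriv x₀ h) (x₀ + θ • z)⟫ *
        ((x₀ + θ • z - x₀) i / θ) ∂μ =
      ∫ z, c * (D z h - N * z h * ∑ a, z a * D z a) * z i ∂μ := by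
    refine setIntegral_congr_fun hmeas fun z hz => ?_
    simp only [hcoord, hgradW z (mem_sphere_zero_iff_norm.1 hz), c]
  have hcombine : -(∫ z, c * ((1 - N) * z h) * D z i ∂μ)
        - ∫ z, (∑ a, z a * D z a) * (c * (δ - N * z h * z i)) ∂μ
        + ∫ z, c * (D z h - N * z h * ∑ a, z a * D z a) * z i ∂μ =
      c * ((N - 1) * ∫ z, z h * D z i ∂μ + ∫ z, z i * D z h ∂μ
        - δ * ∑ a, ∫ z, z a * D z a ∂μ) := by
    rw [← integral_finsetSum _ fun a _ => hint (by have := hD a; fun_prop),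
      ← integral_const_mul, ← integral_const_mul, ← integral_neg,
      ← integral_sub (hint (by fun_prop)) (hint (by fun_prop)),
      ← integral_add (hint (by fun_prop)) (hint (by fun_prop)),
      ← integral_add (hint (by fun_prop)) (hint (by fun_prop)),
      ← integral_sub (hint (by fun_prop)) (hint (by fun_prop)), ← integral_const_mul]
    congr 1 with z
    ring
  simp only [Qform, setIntegral_sphere_eq_unitSphere hs x₀ hθ]
  change -(θ ^ ((N : ℝ) - 1) * ∫ z, _ ∂μ) - θ ^ ((N : ℝ) - 1) * ∫ z, _ ∂μ
    + θ ^ ((N : ℝ) - 1) * ∫ z, _ ∂μ = _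
  rw [hfirst, hsecond, hthird, ← mul_neg, ← mul_sub, ← mul_add, hcombine, ← Finset.mul_sum]
  simp only [c, δ, D, μ]
  rw [← hθpow]
  ring

/-- If `Φ` is harmonic on a ball `B_d(x₀)`, then
`Q_{θ,i}(Φ, W_{x₀,h}) → (∂²Φ/∂x_i∂x_h)(x₀)` as `θ → 0⁺`, where `W_{x₀,h}` is the
derivative of the fundamental solution `S_{x₀}` in the `h`-th coordinate of the pole. -/
theorem Qform_harmonic_poleDeriv_limit {N : ℕ} (hN : 3 ≤ N)
    (x₀ : EuclideanSpace ℝ (Fin N)) (i h : Fin N) (d : ℝ) (hd : 0 < d)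
    (Φ : EuclideanSpace ℝ (Fin N) → ℝ)
    (hΦ : ContDiffOn ℝ 2 Φ (ball x₀ d))
    (hΦ0 : ∀ x ∈ ball x₀ d, laplacian Φ x = 0) :
    Filter.Tendsto (fun θ : ℝ => Qform x₀ θ i Φ (poleDeriv x₀ h))
      (nhdsWithin 0 (Set.Ioi 0))
      (nhds (fderiv ℝ (fun y => fderiv ℝ Φ y (EuclideanSpace.single h 1)) x₀
        (EuclideanSpace.single i 1))) := by
  have hN1 : 1 ≤ N := by omega
  have hNpos : (N : ℝ) ≠ 0 := by positivity
  have hω : omegaN N ≠ 0 := (omegaN_pos hN1).ne'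
  have hx₀ : x₀ ∈ ball x₀ d := mem_ball_self hd
  have hfderivΦ : ContDiffOn ℝ 1 (fderiv ℝ Φ) (ball x₀ d) :=
    hΦ.fderiv_of_isOpen isOpen_ball (by norm_num)
  have hcont (v : EuclideanSpace ℝ (Fin N)) :
      ContinuousOn (fun x => fderiv ℝ Φ x v) (ball x₀ d) :=
    hfderivΦ.continuousOn.clm_apply continuousOn_const
  have hdiffΦ : DifferentiableAt ℝ (fderiv ℝ Φ) x₀ :=
    (hfderivΦ.contDiffAt (ball_mem_nhds x₀ hd)).differentiableAt one_ne_zero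
  have hdiff (v : EuclideanSpace ℝ (Fin N)) :
      DifferentiableAt ℝ (fun x => fderiv ℝ Φ x v) x₀ :=
    hdiffΦ.clm_apply (differentiableAt_const v)
  have hsecond (v w : EuclideanSpace ℝ (Fin N)) :
      fderiv ℝ (fun x => fderiv ℝ Φ x v) x₀ w = fderiv ℝ (fderiv ℝ Φ) x₀ w v := by
    rw [fderiv_clm_apply hdiffΦ (differentiableAt_const v)]
    simp
  have hsymm : IsSymmSndFDerivAt ℝ Φ x₀ :=
    (hΦ.contDiffAt (ball_mem_nhds x₀ hd)).isSymmSndFDerivAt (by simp)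
  have hmoment (a b : Fin N) := tendsto_inv_mul_setIntegral_unitSphere hN1 hd
    (hcont (EuclideanSpace.single b 1)) (hdiff (EuclideanSpace.single b 1)) a
  have hlim := ((((hmoment h i).const_mul ((N : ℝ) - 1)).add (hmoment i h)).sub
    ((tendsto_finsetSum Finset.univ fun a _ => hmoment a a).const_mul
      (if i = h then (1 : ℝ) else 0))).const_mul (omegaN N)⁻¹
  have hlap : ∑ a : Fin N, omegaN N / N * fderiv ℝ
      (fun x => fderiv ℝ Φ x (EuclideanSpace.single a 1)) x₀ (EuclideanSpace.single a 1) = 0 := by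
    have hzero := hΦ0 x₀ hx₀
    rw [laplacian] at hzero
    rw [← Finset.mul_sum, hzero, mul_zero]
  have hvalue : fderiv ℝ (fun x => fderiv ℝ Φ x (EuclideanSpace.single i 1)) x₀
        (EuclideanSpace.single h 1) =
      fderiv ℝ (fun x => fderiv ℝ Φ x (EuclideanSpace.single h 1)) x₀
        (EuclideanSpace.single i 1) := by
    rw [hsecond, hsecond]
    exact hsymm _ _
  rw [hlap, hvalue] at hlim
  convert hlim.congr' ?_ using 2
  · field_simp
    ring
  · filter_upwards [Ioo_mem_nhdsGT hd] with θ hθ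
    exact (Qform_poleDeriv_eq (by omega) x₀ i h hθ.1 fun v =>
      (hcont v).mono ((sphere_subset_closedBall).trans (closedBall_subset_ball hθ.2))).symm
end
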